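/- arXiv:math/0605280 — 2 statements merged into one kernel-verified Lean document; each statement's English description precedes it below -/
import Mathlib

section
/- For all natural numbers s and t, the real geometric algebras satisfy the eightfold periodicity: G(s+8, t) ≅ G(s, t+8) ≅ G(s, t) ⊗[ℝ] Matrix (Fin 16) (Fin 16) ℝ, where all isomorphisms are isomorphisms of ℝ-algebras. -/
open scoped TensorProduct

/-- The quadratic form of signature `(s, t)` on `ℝ^(s+t)`:
`Q x = Σ_{i < s} x i ^ 2 - Σ_{s ≤ i < s+t} x i ^ 2`. -/
noncomputable def Qst (s t : ℕ) : QuadraticForm ℝ (Fin (s + t) → ℝ) :=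
  QuadraticMap.weightedSumSquares ℝ
    (fun i : Fin (s + t) => if (i : ℕ) < s then (1 : ℝ) else -1)

open scoped Quaternion

namespace CliffordAlgebra

theorem commute_of_forall_ι {R M A : Type*} [CommRing R] [AddCommGroup M] [Module R M]
    {Q : QuadraticForm R M} [Ring A] [Algebra R A] (f : CliffordAlgebra Q →ₐ[R] A) {a : A}
    (h : ∀ v, Commute (f (ι Q v)) a) (x : CliffordAlgebra Q) : Commute (f x) a := by
  induction x using CliffordAlgebra.induction with
  | algebraMap r => rw [AlgHom.commutes]; exact Algebra.commutes r a
  | ι v => exact h v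
  | mul x y hx hy => rw [map_mul]; exact hx.mul_left hy
  | add x y hx hy => rw [map_add]; exact hx.add_left hy

section TwistedProduct

variable {R M₁ M₂ : Type*} [CommRing R] [AddCommGroup M₁] [AddCommGroup M₂]
  [Module R M₁] [Module R M₂] (Q₁ : QuadraticForm R M₁) {Q₂ : QuadraticForm R M₂}
  {c : R} {ω : CliffordAlgebra Q₂}

/-- The map `(v, w) ↦ v ⊗ ω + 1 ⊗ w` extends to the Clifford algebra of `c • Q₁ ⊕ Q₂` when `ω`
squares to `c` and anticommutes with vectors. -/
noncomputable def twistedOfProd (hω : ω * ω = algebraMap R _ c)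
    (hanti : ∀ w, ω * ι Q₂ w = -(ι Q₂ w * ω)) :
    CliffordAlgebra ((c • Q₁).prod Q₂) →ₐ[R] CliffordAlgebra Q₁ ⊗[R] CliffordAlgebra Q₂ :=
  lift _ ⟨LinearMap.coprod
      ((TensorProduct.mk R _ _).flip ω ∘ₗ ι Q₁)
      (TensorProduct.mk R _ _ 1 ∘ₗ ι Q₂), by
    rintro ⟨v, w⟩
    simp only [LinearMap.coprod_apply, LinearMap.comp_apply, LinearMap.flip_apply,
      TensorProduct.mk_apply, add_mul, mul_add, Algebra.TensorProduct.tmul_mul_tmul, ι_sq_scalar,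
      hω, hanti, one_mul, mul_one, TensorProduct.tmul_neg, QuadraticMap.prod_apply,
      _root_.smul_apply, map_add, smul_eq_mul]
    simp only [Algebra.algebraMap_eq_smul_one, ← TensorProduct.smul_tmul', TensorProduct.tmul_smul,
      Algebra.TensorProduct.one_def, smul_smul]
    abel⟩

@[simp]
theorem twistedOfProd_ι_mk (hω : ω * ω = algebraMap R _ c)
    (hanti : ∀ w, ω * ι Q₂ w = -(ι Q₂ w * ω)) (v : M₁) (w : M₂) :
    twistedOfProd Q₁ hω hanti (ι _ (v, w)) = ι Q₁ v ⊗ₜ ω + 1 ⊗ₜ ι Q₂ w := by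
  rw [twistedOfProd, lift_ι_apply]
  rfl

theorem twistedOfProd_map_inr (hω : ω * ω = algebraMap R _ c)
    (hanti : ∀ w, ω * ι Q₂ w = -(ι Q₂ w * ω)) (y : CliffordAlgebra Q₂) :
    twistedOfProd Q₁ hω hanti (map (.inr (c • Q₁) Q₂) y) = 1 ⊗ₜ y := by
  have : (twistedOfProd Q₁ hω hanti).comp (map (.inr (c • Q₁) Q₂)) =
      Algebra.TensorProduct.includeRight := by
    ext w
    simp
  exact DFunLike.congr_fun this y

theorem commute_ι_inl_map_inr (Q₁ : QuadraticForm R M₁) (heven : ω ∈ evenOdd Q₂ 0) (v : M₁) :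
    Commute (ι (Q₁.prod Q₂) (v, 0)) (map (.inr Q₁ Q₂) ω) := by
  simpa using commute_map_mul_map_of_isOrtho_of_mem_evenOdd_zero_right
    (.inl Q₁ Q₂) (.inr Q₁ Q₂) (fun _ _ => QuadraticMap.IsOrtho.inl_inr _ _)
    (ι _ v) ω (ι_mem_evenOdd_one _ v) heven

/-- The map `v ↦ c • v * ω` extends to the Clifford algebra of `Q₁`. -/
noncomputable def twistedInl (hω : ω * ω = algebraMap R _ c) (hc : c * c = 1)
    (heven : ω ∈ evenOdd Q₂ 0) : CliffordAlgebra Q₁ →ₐ[R] CliffordAlgebra ((c • Q₁).prod Q₂) :=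
  lift _ ⟨c • LinearMap.mulRight R (map (.inr (c • Q₁) Q₂) ω) ∘ₗ
      ι ((c • Q₁).prod Q₂) ∘ₗ LinearMap.inl R M₁ M₂, fun v => by
    simp only [LinearMap.smul_apply, LinearMap.comp_apply, LinearMap.inl_apply,
      LinearMap.mulRight_apply, smul_mul_smul_comm, hc, one_smul]
    rw [(commute_ι_inl_map_inr _ heven v).symm.mul_mul_mul_comm, ι_sq_scalar, ← map_mul, hω,
      AlgHom.commutes, ← map_mul]
    simp [mul_right_comm, hc]⟩

@[simp]
theorem twistedInl_ι (hω : ω * ω = algebraMap R _ c) (hc : c * c = 1)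
    (heven : ω ∈ evenOdd Q₂ 0) (v : M₁) :
    twistedInl Q₁ hω hc heven (ι Q₁ v) = c • (ι _ (v, 0) * map (.inr (c • Q₁) Q₂) ω) := by
  simp [twistedInl]

theorem commute_twistedInl_map_inr (hω : ω * ω = algebraMap R _ c)
    (hanti : ∀ w, ω * ι Q₂ w = -(ι Q₂ w * ω)) (hc : c * c = 1) (heven : ω ∈ evenOdd Q₂ 0)
    (x : CliffordAlgebra Q₁) (y : CliffordAlgebra Q₂) :
    Commute (twistedInl Q₁ hω hc heven x) (map (.inr (c • Q₁) Q₂) y) := by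
  refine commute_of_forall_ι _ (fun v => (commute_of_forall_ι _ (fun w => ?_) y).symm) x
  rw [twistedInl_ι]
  refine Commute.smul_right ?_ c
  have h₁ := congrArg (map (.inr (c • Q₁) Q₂)) (hanti w)
  have h₂ := ι_mul_ι_comm_of_isOrtho (QuadraticMap.IsOrtho.inl_inr (Q₁ := c • Q₁) (Q₂ := Q₂) v w)
  simp only [map_mul, map_neg, map_apply_ι, QuadraticMap.Isometry.inr_apply] at h₁ ⊢
  rw [Commute, SemiconjBy, mul_assoc, h₁, mul_neg, ← mul_assoc, ← mul_assoc, h₂, neg_mul, neg_neg]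

/-- If `ω` is an even element of the Clifford algebra of `Q₂` that squares to `c = ±1` and
anticommutes with vectors, then the Clifford algebra of `c • Q₁ ⊕ Q₂` is the (ungraded) tensor
product of the Clifford algebras of `Q₁` and `Q₂`. -/
noncomputable def twistedProdEquiv (hω : ω * ω = algebraMap R _ c)
    (hanti : ∀ w, ω * ι Q₂ w = -(ι Q₂ w * ω)) (hc : c * c = 1) (heven : ω ∈ evenOdd Q₂ 0) :
    CliffordAlgebra ((c • Q₁).prod Q₂) ≃ₐ[R] CliffordAlgebra Q₁ ⊗[R] CliffordAlgebra Q₂ :=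
  AlgEquiv.ofAlgHom (twistedOfProd Q₁ hω hanti)
    (Algebra.TensorProduct.lift (twistedInl Q₁ hω hc heven) (map (.inr (c • Q₁) Q₂))
      (commute_twistedInl_map_inr Q₁ hω hanti hc heven))
    (by
      ext v
      · simp [twistedOfProd_map_inr, hω, Algebra.algebraMap_eq_smul_one, smul_smul, hc]
      · simp)
    (by
      ext v
      · simp [mul_assoc, ← map_mul, hω, Algebra.algebraMap_eq_smul_one, smul_smul, hc]
      · simp)

end TwistedProduct

end CliffordAlgebra

namespace CliffordAlgebraQuaternion

open CliffordAlgebra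

variable {R M : Type*} [CommRing R] [AddCommGroup M] [Module R M]

/-- Adding a plane `⟨a, b⟩` with `a * b = 1` to the negative of a quadratic form tensors the
Clifford algebra with a quaternion algebra. -/
noncomputable def negProdEquiv (Q₁ : QuadraticForm R M) {a b : R} (hab : a * b = 1) :
    CliffordAlgebra (((-1 : R) • Q₁).prod (Q a b)) ≃ₐ[R] CliffordAlgebra Q₁ ⊗[R] ℍ[R,a,0,b] :=
  (twistedProdEquiv Q₁ (ω := (quaternionBasis a b).k)
    (by
      rw [(quaternionBasis a b).k_mul_k]
      simp [hab, Algebra.algebraMap_eq_smul_one])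
    (fun w => by
      have hw : ι (Q a b) w = w.1 • (quaternionBasis a b).i + w.2 • (quaternionBasis a b).j := by
        simp only [quaternionBasis, ← map_smul, ← map_add]
        simp
      rw [hw, mul_add, add_mul, neg_add]
      simp only [mul_smul_comm, smul_mul_assoc, QuaternionAlgebra.Basis.k_mul_i,
        QuaternionAlgebra.Basis.k_mul_j, QuaternionAlgebra.Basis.i_mul_k,
        QuaternionAlgebra.Basis.j_mul_k]
      simp)
    (by simp) (ι_mul_ι_mem_evenOdd_zero _ _ _)).trans
  (Algebra.TensorProduct.congr AlgEquiv.refl CliffordAlgebraQuaternion.equiv)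

end CliffordAlgebraQuaternion

namespace QuaternionAlgebra

/-- The split quaternions are the `2 × 2` matrices. -/
noncomputable def splitEquivMatrix : ℍ[ℝ,1,0,1] ≃ₐ[ℝ] Matrix (Fin 2) (Fin 2) ℝ where
  toFun q := !![q.re + q.imI, q.imJ + q.imK; q.imJ - q.imK, q.re - q.imI]
  invFun A := ⟨(A 0 0 + A 1 1) / 2, (A 0 0 - A 1 1) / 2, (A 0 1 + A 1 0) / 2, (A 0 1 - A 1 0) / 2⟩
  left_inv q := by ext <;> simp
  right_inv A := by ext i j; fin_cases i <;> fin_cases j <;> simp <;> ring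
  map_mul' p q := by ext i j; fin_cases i <;> fin_cases j <;> simp [Matrix.mul_apply] <;> ring
  map_add' p q := by ext i j; fin_cases i <;> fin_cases j <;> simp <;> ring
  commutes' r := by
    ext i j; fin_cases i <;> fin_cases j <;> simp [Matrix.algebraMap_matrix_apply]

theorem mulLeftRight_surjective :
    Function.Surjective (AlgHom.mulLeftRight ℝ ℍ[ℝ,-1,0,-1]) := by
  intro f
  let i : ℍ[ℝ,-1,0,-1] := ⟨0, 1, 0, 0⟩
  let j : ℍ[ℝ,-1,0,-1] := ⟨0, 0, 1, 0⟩
  let k : ℍ[ℝ,-1,0,-1] := ⟨0, 0, 0, 1⟩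
  -- The real part of `z` is `(z - i z i - j z j - k z k) / 4`.
  let re : ℍ[ℝ,-1,0,-1] ⊗[ℝ] (ℍ[ℝ,-1,0,-1])ᵐᵒᵖ := (4⁻¹ : ℝ) • (1 ⊗ₜ 1 - i ⊗ₜ .op i - j ⊗ₜ .op j
    - k ⊗ₜ .op k)
  have hre (z : ℍ[ℝ,-1,0,-1]) : AlgHom.mulLeftRight ℝ _ re z = algebraMap ℝ _ z.re := by
    simp only [re, map_smul, map_sub, LinearMap.smul_apply, LinearMap.sub_apply,
      AlgHom.mulLeftRight_apply]
    ext <;> simp [i, j, k]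
    ring
  refine ⟨(f 1 ⊗ₜ 1) * re - (f i ⊗ₜ 1) * re * (i ⊗ₜ 1) - (f j ⊗ₜ 1) * re * (j ⊗ₜ 1)
    - (f k ⊗ₜ 1) * re * (k ⊗ₜ 1), LinearMap.ext fun z => ?_⟩
  have hz : z = z.re • 1 + z.imI • i + z.imJ • j + z.imK • k := by
    ext <;> simp [i, j, k]
  conv_rhs => rw [hz]
  simp only [map_sub, map_mul, map_add, map_smul, LinearMap.sub_apply, Module.End.mul_apply,
    AlgHom.mulLeftRight_apply, hre, ← Algebra.commutes, ← Algebra.smul_def, MulOpposite.unop_one,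
    mul_one]
  simp [i, j, k]

/-- The tensor square of Hamilton's quaternions is the algebra of `4 × 4` matrices. -/
noncomputable def tensorSquareEquivMatrix :
    ℍ[ℝ,-1,0,-1] ⊗[ℝ] ℍ[ℝ,-1,0,-1] ≃ₐ[ℝ] Matrix (Fin 4) (Fin 4) ℝ :=
  (Algebra.TensorProduct.congr AlgEquiv.refl starAe).trans <|
  (AlgEquiv.ofBijective (AlgHom.mulLeftRight ℝ ℍ[ℝ,-1,0,-1])
    ⟨(LinearMap.injective_iff_surjective_of_finrank_eq_finrank
      (f := (AlgHom.mulLeftRight ℝ ℍ[ℝ,-1,0,-1]).toLinearMap)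
      (by
        rw [Module.finrank_tensorProduct, Module.finrank_linearMap,
          (MulOpposite.opLinearEquiv ℝ).symm.finrank_eq])).2
      mulLeftRight_surjective, mulLeftRight_surjective⟩).trans <|
  LinearMap.toMatrixAlgEquiv (basisOneIJK (-1) 0 (-1))

end QuaternionAlgebra

namespace QuadraticMap

/-- Splitting off two coordinates of a diagonal quadratic form, with the remaining weights
negated. -/
noncomputable def weightedSumSquaresEquivNegProd {R ι κ : Type*} [CommRing R] [Fintype ι]
    [Fintype κ] (w : ι → R) (v : κ → R) (a b : R) (e : κ ⊕ Fin 2 ≃ ι)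
    (hw : ∀ x, w (e x) = Sum.elim (-v) ![a, b] x) :
    (weightedSumSquares R w).IsometryEquiv
      (((-1 : R) • weightedSumSquares R v).prod (CliffordAlgebraQuaternion.Q a b)) where
  __ := (LinearEquiv.funCongrLeft R R e).trans <|
    (LinearEquiv.sumArrowLequivProdArrow κ (Fin 2) R R).trans <|
    (LinearEquiv.refl R _).prodCongr (LinearEquiv.finTwoArrow R R)
  map_app' m := by
    simp [weightedSumSquares_apply, ← e.sum_comp, hw, LinearEquiv.funCongrLeft_apply,
      LinearMap.funLeft]

end QuadraticMap

namespace Qst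

open QuadraticMap CliffordAlgebraQuaternion

/-- `Q(s+2, t)` is the orthogonal sum of `-Q(t, s)` and a positive definite plane. -/
noncomputable def addTwoLeft (s t : ℕ) :
    (Qst (s + 2) t).IsometryEquiv (((-1 : ℝ) • Qst t s).prod (Q 1 1)) :=
  weightedSumSquaresEquivNegProd _ _ 1 1
    ((finSumFinEquiv.symm.sumCongr (.refl _)).trans <| (Equiv.sumAssoc _ _ _).trans <|
      (Equiv.sumComm _ _).trans <| (finSumFinEquiv.sumCongr (.refl _)).trans finSumFinEquiv) <| by
    rintro (x | x)
    · obtain ⟨x | x, rfl⟩ := finSumFinEquiv.surjective x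
      · simp
      · simp [show ¬ s + 2 ≤ (x : ℕ) by lia]
    · fin_cases x <;> simp

/-- `Q(s, t+2)` is the orthogonal sum of `-Q(t, s)` and a negative definite plane. -/
noncomputable def addTwoRight (s t : ℕ) :
    (Qst s (t + 2)).IsometryEquiv (((-1 : ℝ) • Qst t s).prod (Q (-1) (-1))) :=
  weightedSumSquaresEquivNegProd _ _ (-1) (-1)
    (((finSumFinEquiv.symm.trans (.sumComm _ _)).sumCongr (.refl _)).trans <|
      (Equiv.sumAssoc _ _ _).trans <| ((Equiv.refl _).sumCongr finSumFinEquiv).trans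
        finSumFinEquiv) <| by
    rintro (x | x)
    · obtain ⟨x | x, rfl⟩ := finSumFinEquiv.surjective x
      · simp
      · simp
    · fin_cases x <;> simp

open CliffordAlgebra

/-- `G(s+2, t) ≅ G(t, s) ⊗ ℝ^{2×2}`. -/
noncomputable def cliffordAddTwoLeft (s t : ℕ) : CliffordAlgebra (Qst (s + 2) t) ≃ₐ[ℝ]
    CliffordAlgebra (Qst t s) ⊗[ℝ] Matrix (Fin 2) (Fin 2) ℝ :=
  (equivOfIsometry (addTwoLeft s t)).trans <| (negProdEquiv _ (by norm_num)).trans <|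
    Algebra.TensorProduct.congr .refl QuaternionAlgebra.splitEquivMatrix

/-- `G(s, t+2) ≅ G(t, s) ⊗ ℍ`. -/
noncomputable def cliffordAddTwoRight (s t : ℕ) : CliffordAlgebra (Qst s (t + 2)) ≃ₐ[ℝ]
    CliffordAlgebra (Qst t s) ⊗[ℝ] ℍ[ℝ,-1,0,-1] :=
  (equivOfIsometry (addTwoRight s t)).trans <| negProdEquiv _ (by norm_num)

/-- `G(s+4, t) ≅ G(s, t) ⊗ (ℍ ⊗ ℝ^{2×2})`. -/
noncomputable def cliffordAddFourLeft (s t : ℕ) : CliffordAlgebra (Qst (s + 4) t) ≃ₐ[ℝ]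
    CliffordAlgebra (Qst s t) ⊗[ℝ] (ℍ[ℝ,-1,0,-1] ⊗[ℝ] Matrix (Fin 2) (Fin 2) ℝ) :=
  (cliffordAddTwoLeft (s + 2) t).trans <|
    (Algebra.TensorProduct.congr (cliffordAddTwoRight t s) .refl).trans <|
    Algebra.TensorProduct.assoc ℝ ℝ ℝ _ _ _

/-- `G(s, t+4) ≅ G(s, t) ⊗ (ℍ ⊗ ℝ^{2×2})`. -/
noncomputable def cliffordAddFourRight (s t : ℕ) : CliffordAlgebra (Qst s (t + 4)) ≃ₐ[ℝ]
    CliffordAlgebra (Qst s t) ⊗[ℝ] (ℍ[ℝ,-1,0,-1] ⊗[ℝ] Matrix (Fin 2) (Fin 2) ℝ) :=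
  (cliffordAddTwoRight s (t + 2)).trans <|
    (Algebra.TensorProduct.congr (cliffordAddTwoLeft t s) .refl).trans <|
    (Algebra.TensorProduct.assoc ℝ ℝ ℝ _ _ _).trans <|
    Algebra.TensorProduct.congr .refl (Algebra.TensorProduct.comm ℝ _ _)

/-- The tensor square of `ℍ ⊗ ℝ^{2×2}` is `ℝ^{16×16}`. -/
noncomputable def tensorSquareEquivMatrix :
    (ℍ[ℝ,-1,0,-1] ⊗[ℝ] Matrix (Fin 2) (Fin 2) ℝ) ⊗[ℝ]
      (ℍ[ℝ,-1,0,-1] ⊗[ℝ] Matrix (Fin 2) (Fin 2) ℝ) ≃ₐ[ℝ] Matrix (Fin 16) (Fin 16) ℝ :=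
  (Algebra.TensorProduct.tensorTensorTensorComm ℝ ℝ ℝ ℝ _ _ _ _).trans <|
    (Algebra.TensorProduct.congr QuaternionAlgebra.tensorSquareEquivMatrix
      (Matrix.kroneckerAlgEquiv (Fin 2) (Fin 2) ℝ)).trans <|
    (Matrix.kroneckerAlgEquiv _ _ ℝ).trans <|
    Matrix.reindexAlgEquiv ℝ ℝ <| (Equiv.prodCongr (.refl _) finProdFinEquiv).trans finProdFinEquiv

/-- `G(s+8, t) ≅ G(s, t) ⊗ ℝ^{16×16}`. -/
noncomputable def cliffordAddEightLeft (s t : ℕ) : CliffordAlgebra (Qst (s + 8) t) ≃ₐ[ℝ]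
    CliffordAlgebra (Qst s t) ⊗[ℝ] Matrix (Fin 16) (Fin 16) ℝ :=
  (cliffordAddFourLeft (s + 4) t).trans <|
    (Algebra.TensorProduct.congr (cliffordAddFourLeft s t) .refl).trans <|
    (Algebra.TensorProduct.assoc ℝ ℝ ℝ _ _ _).trans <|
    Algebra.TensorProduct.congr .refl tensorSquareEquivMatrix

/-- `G(s, t+8) ≅ G(s, t) ⊗ ℝ^{16×16}`. -/
noncomputable def cliffordAddEightRight (s t : ℕ) : CliffordAlgebra (Qst s (t + 8)) ≃ₐ[ℝ]
    CliffordAlgebra (Qst s t) ⊗[ℝ] Matrix (Fin 16) (Fin 16) ℝ :=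
  (cliffordAddFourRight s (t + 4)).trans <|
    (Algebra.TensorProduct.congr (cliffordAddFourRight s t) .refl).trans <|
    (Algebra.TensorProduct.assoc ℝ ℝ ℝ _ _ _).trans <|
    Algebra.TensorProduct.congr .refl tensorSquareEquivMatrix

end Qst

/-- **Eightfold periodicity of real geometric algebras:**
`G(s+8, t) ≅ G(s, t+8) ≅ G(s, t) ⊗[ℝ] ℝ^{16×16}` as ℝ-algebras. -/
theorem clifford_eightfold_periodicity (s t : ℕ) :
    Nonempty (CliffordAlgebra (Qst (s + 8) t) ≃ₐ[ℝ] CliffordAlgebra (Qst s (t + 8))) ∧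
    Nonempty (CliffordAlgebra (Qst (s + 8) t) ≃ₐ[ℝ]
      (CliffordAlgebra (Qst s t) ⊗[ℝ] Matrix (Fin 16) (Fin 16) ℝ)) ∧
    Nonempty (CliffordAlgebra (Qst s (t + 8)) ≃ₐ[ℝ]
      (CliffordAlgebra (Qst s t) ⊗[ℝ] Matrix (Fin 16) (Fin 16) ℝ)) :=
  ⟨⟨(Qst.cliffordAddEightLeft s t).trans (Qst.cliffordAddEightRight s t).symm⟩,
    ⟨Qst.cliffordAddEightLeft s t⟩, ⟨Qst.cliffordAddEightRight s t⟩⟩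
end

section
/- Let V be a finite-dimensional real vector space and Q a nondegenerate quadratic form on V, and define the norm function N(x) := reverse (involute x) * x on CliffordAlgebra Q. Then for every element x of the Lipschitz group Γ̃ there is a nonzero real number c(x) with N(x) = algebraMap ℝ (CliffordAlgebra Q) (c x); moreover N is multiplicative on Γ̃: for all x, y ∈ Γ̃, N(x * y) = N(x) * N(y) (equivalently c(xy) = c(x)·c(y)). In other words, N restricts to a group homomorphism from Γ̃ to the multiplicative group of nonzero reals. -/
open CliffordAlgebra

variable {V : Type*} [AddCommGroup V] [Module ℝ V]

/-- The Lipschitz group `Γ̃` of a quadratic form: the invertible elements `x` of the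
Clifford algebra such that the twisted conjugation `v ↦ involute x * ι v * x⁻¹` preserves
the space of vectors. -/
def lipschitzSet (Q : QuadraticForm ℝ V) : Set (CliffordAlgebra Q) :=
  {x | ∃ y : CliffordAlgebra Q, x * y = 1 ∧ y * x = 1 ∧
    ∀ v : V, involute x * ι Q v * y ∈ Set.range (ι Q)}

/-- The norm function `N(x) = x^□ x = reverse (involute x) * x` on the Clifford algebra. -/
noncomputable def cliffordNorm {Q : QuadraticForm ℝ V} (x : CliffordAlgebra Q) :
    CliffordAlgebra Q :=
  reverse (involute x) * x

/-- Contraction by the polar form of `v` is the twisted commutator with `ι Q v`. -/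
theorem contractLeft_polarBilin {R M : Type*} [CommRing R] [AddCommGroup M] [Module R M]
    (Q : QuadraticForm R M) (v : M) (x : CliffordAlgebra Q) :
    contractLeft (Q.polarBilin v) x = ι Q v * x - involute x * ι Q v := by
  induction x using CliffordAlgebra.left_induction with
  | algebraMap r => simp [Algebra.commutes]
  | add x y hx hy => simp only [map_add, hx, hy]; noncomm_ring
  | ι_mul x a hx =>
    rw [contractLeft_ι_mul, hx, map_mul, involute_ι, QuadraticMap.polarBilin_apply_apply,
      Algebra.smul_def, ← ι_mul_ι_add_swap]
    noncomm_ring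

/-- Euler's identity: on the `n`-th exterior power, `∑ i, bᵢ ∧ (bᵢ* ⌋ x) = n x`. -/
theorem ExteriorAlgebra.sum_ι_mul_contractLeft {R M ι' : Type*} [CommRing R] [AddCommGroup M]
    [Module R M] [Fintype ι'] (b : Module.Basis ι' R M) (n : ℕ) (x : ExteriorAlgebra R M)
    (hx : x ∈ ⋀[R]^n M) :
    ∑ i, ExteriorAlgebra.ι R (b i) * contractLeft (Q := (0 : QuadraticForm R M)) (b.coord i) x =
      n • x := by
  induction hx using Submodule.pow_induction_on_left' with
  | algebraMap r =>
    refine (Finset.sum_eq_zero fun i _ => ?_).trans (zero_smul ℕ _).symm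
    exact (congrArg _ (contractLeft_algebraMap _ _ r)).trans (mul_zero _)
  | add x y n hx hy ihx ihy =>
    simp only [map_add, mul_add, Finset.sum_add_distrib, ihx, ihy, smul_add]
  | mem_mul m hm n x hx ih =>
    obtain ⟨a, rfl⟩ := hm
    have key : ∀ i, ExteriorAlgebra.ι R (b i) *
        contractLeft (Q := (0 : QuadraticForm R M)) (b.coord i) (ExteriorAlgebra.ι R a * x) =
        ExteriorAlgebra.ι R (b.coord i a • b i) * x + ExteriorAlgebra.ι R a *
          (ExteriorAlgebra.ι R (b i) *
            contractLeft (Q := (0 : QuadraticForm R M)) (b.coord i) x) := by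
      intro i
      have h := contractLeft_ι_mul (Q := (0 : QuadraticForm R M)) (b.coord i) a x
      have hs : ExteriorAlgebra.ι R (b i) * ExteriorAlgebra.ι R a =
          -(ExteriorAlgebra.ι R a * ExteriorAlgebra.ι R (b i)) :=
        eq_neg_of_add_eq_zero_left (ExteriorAlgebra.ι_add_mul_swap _ _)
      refine (congrArg _ h).trans ?_
      rw [mul_sub, ← mul_assoc, hs, map_smul, mul_smul_comm, smul_mul_assoc, neg_mul,
        sub_neg_eq_add, mul_assoc]
    simp_rw [key]
    rw [Finset.sum_add_distrib, ← Finset.mul_sum, ih, ← Finset.sum_mul, ← map_sum]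
    simp only [Module.Basis.coord_apply, b.sum_repr]
    rw [mul_smul_comm, succ_nsmul']

/-- In characteristic zero, an element of the exterior algebra annihilated by all contractions
is a scalar. -/
theorem ExteriorAlgebra.mem_range_algebraMap_of_contractLeft_eq_zero {K M : Type*} [Field K]
    [CharZero K] [AddCommGroup M] [Module K M] [FiniteDimensional K M] (x : ExteriorAlgebra K M)
    (hx : ∀ d : Module.Dual K M, contractLeft (Q := (0 : QuadraticForm K M)) d x = 0) :
    x ∈ Set.range (algebraMap K (ExteriorAlgebra K M)) := by
  classical
  let b := Module.finBasis K M
  let E : ExteriorAlgebra K M →ₗ[K] ExteriorAlgebra K M :=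
    ∑ i, LinearMap.mulLeft K (ExteriorAlgebra.ι K (b i)) ∘ₗ
      contractLeft (Q := (0 : QuadraticForm K M)) (b.coord i)
  have hE : ∀ n, ∀ y ∈ ⋀[K]^n M, E y = n • y := fun n y hy => by
    rw [← ExteriorAlgebra.sum_ι_mul_contractLeft b n y hy]
    simp only [E, LinearMap.sum_apply, LinearMap.comp_apply, LinearMap.mulLeft_apply]
  have hEx : E x = 0 := by
    simp only [E, LinearMap.sum_apply, LinearMap.comp_apply, LinearMap.mulLeft_apply]
    refine Finset.sum_eq_zero fun i _ => ?_
    exact (congrArg _ (hx _)).trans (mul_zero _)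
  let 𝒜 : ℕ → Submodule K (ExteriorAlgebra K M) := fun n => ⋀[K]^n M
  have hproj : ∀ (n : ℕ) (y : ExteriorAlgebra K M),
      (DirectSum.decompose 𝒜 (E y) n : ExteriorAlgebra K M) =
        n • (DirectSum.decompose 𝒜 y n : ExteriorAlgebra K M) := by
    intro n y
    induction y using DirectSum.Decomposition.inductionOn 𝒜 with
    | zero => simp
    | @homogeneous i m =>
      rw [hE i m m.2, ← Nat.cast_smul_eq_nsmul K i, DirectSum.decompose_smul,
        DirectSum.decompose_coe, DirectSum.smul_apply, Submodule.coe_smul,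
        Nat.cast_smul_eq_nsmul]
      by_cases h : i = n
      · subst h; rw [DirectSum.of_eq_same]
      · rw [DirectSum.of_eq_of_ne _ _ _ (Ne.symm h), ZeroMemClass.coe_zero, smul_zero, smul_zero]
    | add y z hy hz => simp [hy, hz, DirectSum.decompose_add]
  have hzero : ∀ n, n ≠ 0 → (DirectSum.decompose 𝒜 x n : ExteriorAlgebra K M) = 0 := by
    intro n hn
    have h := hproj n x
    rw [hEx, DirectSum.decompose_zero, DirectSum.zero_apply, ZeroMemClass.coe_zero,
      ← Nat.cast_smul_eq_nsmul K] at h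
    exact (smul_eq_zero.mp h.symm).resolve_left (Nat.cast_ne_zero.mpr hn)
  have hx0 : x = (DirectSum.decompose 𝒜 x 0 : ExteriorAlgebra K M) := by
    conv_lhs => rw [← DirectSum.sum_support_decompose 𝒜 x]
    refine Finset.sum_eq_single 0 (fun n _ hn => hzero n hn) fun h => ?_
    rw [DFinsupp.notMem_support_iff.mp h, ZeroMemClass.coe_zero]
  have hmem : x ∈ ⋀[K]^0 M := hx0 ▸ (DirectSum.decompose 𝒜 x 0).2
  exact Submodule.mem_one.mp hmem

/-- In characteristic zero, an element of a Clifford algebra annihilated by all contractions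
is a scalar. -/
theorem mem_range_algebraMap_of_contractLeft_eq_zero {K M : Type*} [Field K] [CharZero K]
    [AddCommGroup M] [Module K M] [FiniteDimensional K M] (Q : QuadraticForm K M)
    (x : CliffordAlgebra Q) (hx : ∀ d : Module.Dual K M, contractLeft d x = 0) :
    x ∈ Set.range (algebraMap K (CliffordAlgebra Q)) := by
  have : Invertible (2 : K) := invertibleOfNonzero two_ne_zero
  obtain ⟨r, hr⟩ := ExteriorAlgebra.mem_range_algebraMap_of_contractLeft_eq_zero
    (equivExterior Q x) fun d => by
      have h := changeForm_contractLeft (changeForm.associated_neg_proof (Q := Q)) d x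
      rw [hx d, map_zero] at h
      exact h.symm
  refine ⟨r, (equivExterior Q).injective (Eq.trans ?_ hr)⟩
  exact changeForm_algebraMap changeForm.associated_neg_proof r

/-- For nondegenerate `Q`, the twisted centralizer of the vectors consists of the scalars. -/
theorem mem_range_algebraMap_of_involute_mul_ι_eq {K M : Type*} [Field K] [CharZero K]
    [AddCommGroup M] [Module K M] [FiniteDimensional K M] (Q : QuadraticForm K M)
    (hQ : Q.polarBilin.Nondegenerate) (x : CliffordAlgebra Q)
    (hx : ∀ v, involute x * ι Q v = ι Q v * x) :
    x ∈ Set.range (algebraMap K (CliffordAlgebra Q)) := by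
  refine mem_range_algebraMap_of_contractLeft_eq_zero Q x fun d => ?_
  obtain ⟨v, rfl⟩ := (LinearMap.BilinForm.toDual Q.polarBilin hQ).surjective d
  exact (contractLeft_polarBilin Q v x).trans (sub_eq_zero.mpr (hx v).symm)

theorem cliffordNorm_mem_range_algebraMap [FiniteDimensional ℝ V] (Q : QuadraticForm ℝ V)
    (hQ : Q.polarBilin.Nondegenerate) {x : CliffordAlgebra Q} (hx : x ∈ lipschitzSet Q) :
    cliffordNorm x ∈ Set.range (algebraMap ℝ (CliffordAlgebra Q)) := by
  obtain ⟨y, -, hyx, h⟩ := hx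
  refine mem_range_algebraMap_of_involute_mul_ι_eq Q hQ _ fun v => ?_
  obtain ⟨w, hw⟩ := h v
  have h₁ : ι Q w * x = involute x * ι Q v := by rw [hw, mul_assoc, hyx, mul_one]
  have h₂ : reverse x * ι Q w = ι Q v * reverse (involute x) := by
    simpa only [reverse.map_mul, reverse_ι] using congrArg reverse h₁
  rw [cliffordNorm, map_mul, ← reverse_involute, involute_involute, mul_assoc, ← h₁, ← mul_assoc,
    h₂, mul_assoc]

theorem isUnit_cliffordNorm {Q : QuadraticForm ℝ V} {x : CliffordAlgebra Q}
    (hx : x ∈ lipschitzSet Q) : IsUnit (cliffordNorm x) := by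
  obtain ⟨y, hxy, hyx, -⟩ := hx
  have conj_mul : ∀ {a b : CliffordAlgebra Q}, a * b = 1 →
      reverse (involute b) * reverse (involute a) = 1 := fun {a b} h => by
    rw [← reverse.map_mul, ← map_mul, h, map_one, reverse.map_one]
  exact IsUnit.mul ⟨⟨_, _, conj_mul hyx, conj_mul hxy⟩, rfl⟩ ⟨⟨x, y, hxy, hyx⟩, rfl⟩

theorem cliffordNorm_mul_of_eq_algebraMap {Q : QuadraticForm ℝ V} {x : CliffordAlgebra Q} {r : ℝ}
    (hx : cliffordNorm x = algebraMap ℝ _ r) (y : CliffordAlgebra Q) :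
    cliffordNorm (x * y) = cliffordNorm x * cliffordNorm y := by
  calc cliffordNorm (x * y) = reverse (involute y) * cliffordNorm x * y := by
        simp only [cliffordNorm, map_mul, reverse.map_mul, mul_assoc]
    _ = cliffordNorm x * cliffordNorm y := by
        rw [hx, ← Algebra.commutes, mul_assoc, cliffordNorm]

/-- **The norm function is a homomorphism `Γ̃ → ℝˣ`.**
For `Q` nondegenerate on a finite-dimensional real space: every element `x` of the
Lipschitz group has `N(x)` equal to a nonzero scalar `c x`, and both `N` and `c` are
multiplicative on the Lipschitz group. -/
theorem norm_function_hom_on_lipschitz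
    [FiniteDimensional ℝ V] (Q : QuadraticForm ℝ V) (hQ : Q.polarBilin.Nondegenerate) :
    ∃ c : CliffordAlgebra Q → ℝ,
      (∀ x ∈ lipschitzSet Q, c x ≠ 0 ∧
        cliffordNorm x = algebraMap ℝ (CliffordAlgebra Q) (c x)) ∧
      (∀ x ∈ lipschitzSet Q, ∀ y ∈ lipschitzSet Q,
        cliffordNorm (x * y) = cliffordNorm x * cliffordNorm y ∧
        c (x * y) = c x * c y) := by
  classical
  let c : CliffordAlgebra Q → ℝ :=
    Function.invFun (algebraMap ℝ (CliffordAlgebra Q)) ∘ cliffordNorm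
  have hinj : Function.Injective (algebraMap ℝ (CliffordAlgebra Q)) :=
    (algebraMap ℝ (CliffordAlgebra Q)).injective
  have hc : ∀ x ∈ lipschitzSet Q, cliffordNorm x = algebraMap ℝ (CliffordAlgebra Q) (c x) :=
    fun x hx => (Function.invFun_eq (cliffordNorm_mem_range_algebraMap Q hQ hx)).symm
  refine ⟨c, fun x hx => ⟨fun h => ?_, hc x hx⟩, fun x hx y hy => ?_⟩
  · refine (isUnit_cliffordNorm hx).ne_zero ?_
    rw [hc x hx, h, map_zero]
  · have hmul := cliffordNorm_mul_of_eq_algebraMap (hc x hx) y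
    refine ⟨hmul, ?_⟩
    change Function.invFun _ (cliffordNorm (x * y)) = _
    rw [hmul, hc x hx, hc y hy, ← map_mul, Function.leftInverse_invFun hinj]
end
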